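/- Let Δ, x, y be integers with Δ ≥ 2, 0 ≤ x ≤ Δ and 1 ≤ y ≤ Δ-1. Let C be a multiset of Δ nonempty subsets of {M,P,O,X} that is universally closed for the collection of black configurations of Φ_Δ(x,y). Then C extends to one of the following two multisets of subsets: (y-1 copies of {M,P,O,X}) + (one copy of {M}) + (Δ-y copies of {P,O,X}); or (y copies of {M,P,O,X}) + (Δ-y copies of {O,X}). -/

import Mathlib

/-- The four-element alphabet {M, P, O, X}. -/
inductive Label4 where
  | M | P | O | X
deriving DecidableEq

open Label4

/-- Black configurations of Φ_Δ(x,y). -/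
def blackPhi (Δ x y : ℕ) (w : Multiset Label4) : Prop :=
  (∃ s u, w = s + (M ::ₘ u) ∧ Multiset.card s = y - 1 ∧
    Multiset.card u = Δ - y ∧ ∀ l ∈ u, l ∈ ({P, O, X} : Finset Label4)) ∨
  (∃ s, w = s + Multiset.replicate (Δ - x) O ∧ Multiset.card s = x ∧
    ∀ l ∈ s, l ∈ ({O, X} : Finset Label4))

/-- `C` is universally closed for the collection `B`: every multiset obtained by
choosing one label from each subset in `C` belongs to `B`. -/
def universallyClosed {σ : Type*} (B : Multiset σ → Prop) (C : Multiset (Finset σ)) : Prop :=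
  ∀ w : Multiset σ, Multiset.Rel (fun l F => l ∈ F) w C → B w

theorem Finset.subset_label4_univ (F : Finset Label4) : F ⊆ {M, P, O, X} := by
  intro l _
  cases l <;> simp

theorem Finset.subset_POX_iff (F : Finset Label4) : F ⊆ {P, O, X} ↔ M ∉ F := by
  constructor
  · intro h hM
    simpa using h hM
  · intro h l hl
    cases l <;> simp_all

theorem Multiset.rel_mem_map {α : Type*} {C : Multiset (Finset α)} {f : Finset α → α}
    (hf : ∀ F ∈ C, f F ∈ F) : Multiset.Rel (fun l F => l ∈ F) (C.map f) C := by
  rw [Multiset.rel_map_left]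
  exact Multiset.rel_refl_of_refl_on hf

/-- If at most `a` members of `C` are not contained in `S`, then `C` extends to `a` copies of
any common upper bound `U` together with copies of `S`. -/
theorem Multiset.rel_subset_replicate_add_replicate {α : Type*} [DecidableEq α]
    {U S : Finset α} {C : Multiset (Finset α)} {a b : ℕ} (hU : ∀ F ∈ C, F ⊆ U)
    (hcard : card C = a + b) (hle : C.countP (fun F => ¬ F ⊆ S) ≤ a) :
    Multiset.Rel (· ⊆ ·) C (replicate a U + replicate b S) := by
  induction C using Multiset.induction generalizing a b with
  | empty =>
    obtain ⟨rfl, rfl⟩ : a = 0 ∧ b = 0 := by simpa using hcard.symm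
    simp
  | cons F C ih =>
    have hF : F ⊆ U := hU F (mem_cons_self F C)
    have hU' : ∀ G ∈ C, G ⊆ U := fun G hG => hU G (mem_cons_of_mem hG)
    rw [card_cons] at hcard
    by_cases hS : F ⊆ S
    · rw [countP_cons_of_neg (p := fun F => ¬ F ⊆ S) _ (not_not_intro hS)] at hle
      cases b with
      | succ b =>
        rw [replicate_succ, add_cons]
        exact .cons hS (ih hU' (by omega) hle)
      | zero =>
        obtain rfl : a = card C + 1 := hcard.symm
        rw [replicate_succ, cons_add]
        exact .cons hF (ih hU' rfl (countP_le_card _ _))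
    · rw [countP_cons_of_pos (p := fun F => ¬ F ⊆ S) _ hS] at hle
      obtain ⟨a, rfl⟩ : ∃ a', a = a' + 1 := ⟨a - 1, by omega⟩
      rw [replicate_succ, cons_add]
      exact .cons hF (ih hU' (by omega) (by omega))

theorem blackPhi.count_M_le {Δ x y : ℕ} {w : Multiset Label4} (hy : 1 ≤ y)
    (h : blackPhi Δ x y w) : w.count M ≤ y := by
  rcases h with ⟨s, u, rfl, hs, -, hu⟩ | ⟨s, rfl, -, hs⟩
  · have hMu : M ∉ u := fun hM => by simpa using hu M hM
    have hMs := s.count_le_card M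
    rw [Multiset.count_add, Multiset.count_cons_self, Multiset.count_eq_zero_of_notMem hMu]
    omega
  · have hMs : M ∉ s := fun hM => by simpa using hs M hM
    simp [Multiset.count_eq_zero_of_notMem hMs, Multiset.count_replicate]

theorem blackPhi.M_mem_of_P_mem {Δ x y : ℕ} {w : Multiset Label4}
    (h : blackPhi Δ x y w) (hP : P ∈ w) : M ∈ w := by
  rcases h with ⟨s, u, rfl, -⟩ | ⟨s, rfl, -, hs⟩
  · simp
  · rcases Multiset.mem_add.1 hP with hP | hP
    · simpa using hs P hP
    · simpa using Multiset.eq_of_mem_replicate hP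

theorem universallyClosed.countP_M_mem_le {Δ x y : ℕ} {C : Multiset (Finset Label4)}
    (hy : 1 ≤ y) (hne : ∀ F ∈ C, F.Nonempty)
    (hclosed : universallyClosed (blackPhi Δ x y) C) : C.countP (fun F => M ∈ F) ≤ y := by
  have hex : ∀ F : Finset Label4, ∃ l, (F.Nonempty → l ∈ F) ∧ (M ∈ F → M = l) := by
    intro F
    by_cases hM : M ∈ F
    · exact ⟨M, fun _ => hM, fun _ => rfl⟩
    · by_cases hF : F.Nonempty
      · exact ⟨hF.choose, fun _ => hF.choose_spec, fun h => absurd h hM⟩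
      · exact ⟨M, fun h => absurd h hF, fun h => absurd h hM⟩
  choose f hmem hM using hex
  have hw := (hclosed _ (Multiset.rel_mem_map fun F hF => hmem F (hne F hF))).count_M_le hy
  rw [Multiset.count_map, ← Multiset.countP_eq_card_filter] at hw
  refine le_trans ?_ hw
  rw [Multiset.countP_eq_card_filter, Multiset.countP_eq_card_filter]
  exact Multiset.card_le_card (Multiset.monotone_filter_right C fun F => hM F)

theorem universallyClosed.P_notMem {Δ x y : ℕ} {C : Multiset (Finset Label4)}
    (hne : ∀ F ∈ C, F.Nonempty) (hM : {M} ∉ C)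
    (hclosed : universallyClosed (blackPhi Δ x y) C) {F : Finset Label4} (hF : F ∈ C) :
    P ∉ F := by
  intro hP
  have hex : ∀ G : Finset Label4, ∃ l, (G ∈ C → l ∈ G ∧ l ≠ M) ∧ (P ∈ G → l = P) := by
    intro G
    by_cases hPG : P ∈ G
    · exact ⟨P, fun _ => ⟨hPG, by simp⟩, fun _ => rfl⟩
    · by_cases hG : G ∈ C
      · obtain ⟨l, hl, hlM⟩ : ∃ l ∈ G, l ≠ M := by
          by_contra! h
          exact hM ((Finset.eq_singleton_iff_nonempty_unique_mem.2 ⟨hne G hG, h⟩) ▸ hG)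
        exact ⟨l, fun _ => ⟨hl, hlM⟩, fun h => absurd h hPG⟩
      · exact ⟨M, fun h => absurd h hG, fun h => absurd h hPG⟩
  choose f hmem hfP using hex
  have hw := (hclosed _ (Multiset.rel_mem_map fun G hG => (hmem G hG).1)).M_mem_of_P_mem
    (Multiset.mem_map.2 ⟨F, hF, hfP F hP⟩)
  obtain ⟨G, hG, hGM⟩ := Multiset.mem_map.1 hw
  exact (hmem G hG).2 hGM

theorem stmt1 (Δ x y : ℕ) (hΔ : 2 ≤ Δ) (hx : x ≤ Δ) (hy1 : 1 ≤ y) (hy2 : y ≤ Δ - 1)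
    (C : Multiset (Finset Label4)) (hcard : Multiset.card C = Δ)
    (hne : ∀ F ∈ C, F.Nonempty)
    (hclosed : universallyClosed (blackPhi Δ x y) C) :
    Multiset.Rel (· ⊆ ·) C
      (Multiset.replicate (y - 1) ({M, P, O, X} : Finset Label4) +
        (({M} : Finset Label4) ::ₘ
          Multiset.replicate (Δ - y) ({P, O, X} : Finset Label4))) ∨
    Multiset.Rel (· ⊆ ·) C
      (Multiset.replicate y ({M, P, O, X} : Finset Label4) +
        Multiset.replicate (Δ - y) ({O, X} : Finset Label4)) := by
  have hcount := hclosed.countP_M_mem_le hy1 hne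
  by_cases hM : {M} ∈ C
  · left
    obtain ⟨D, rfl⟩ := Multiset.exists_cons_of_mem hM
    rw [Multiset.countP_cons_of_pos (p := fun F => M ∈ F) _ (Finset.mem_singleton_self M)]
      at hcount
    rw [Multiset.card_cons] at hcard
    rw [Multiset.add_cons]
    refine .cons (Finset.Subset.refl _) (Multiset.rel_subset_replicate_add_replicate
      (fun F _ => F.subset_label4_univ) (by omega) ?_)
    simp only [Finset.subset_POX_iff, not_not]
    omega
  · right
    refine Multiset.rel_subset_replicate_add_replicate
      (fun F _ => F.subset_label4_univ) (by omega) (le_trans (le_of_eq ?_) hcount)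
    refine Multiset.countP_congr rfl fun F hF => ?_
    have hP := hclosed.P_notMem hne hM hF
    rw [eq_iff_iff, ← not_iff_not, not_not, ← Finset.subset_POX_iff]
    constructor
    · exact fun h => h.trans (by simp)
    · intro h l hl
      have := h hl
      cases l <;> simp_all
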